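/- Let Θ = (Θ_i)_{i∈ℤ^d} be a random element of ℝ^{ℤ^d} with |Θ_0| = 1 almost surely, let α > 0, and let V be a Pareto(α)-distributed random variable independent of Θ. Then the time-change formula with index α holds for Θ (for all measurable h : ℝ^{ℤ^d} → [0,∞) and all k ∈ ℤ^d) if and only if the random element Y := V·Θ = (V Θ_i)_{i∈ℤ^d} is exceedance-stationary. -/

import Mathlib

open MeasureTheory ENNReal Filter ProbabilityTheory

noncomputable section

/-- The space `ℝ^{ℤ^d}` of real-valued fields indexed by `ℤ^d`. -/
abbrev RField (d : ℕ) := (Fin d → ℤ) → ℝ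

variable {d : ℕ}

/-- Shift operator: `shift k x = (x_{i+k})_i`, i.e. it moves the origin to `k`. -/
def shift (k : Fin d → ℤ) (x : RField d) : RField d := fun i => x (i + k)

/-- The set of exceedance-points of `x`. -/
def excSet (x : RField d) : Set (Fin d → ℤ) := {k | 1 < |x k|}

open Classical in
/-- Indicator (with values in `ℝ≥0∞`) of the event that `|x k| > s`. -/
def exIndGT (s : ℝ) (k : Fin d → ℤ) (x : RField d) : ℝ≥0∞ := if s < |x k| then 1 else 0

/-- The tail-process identity:
`E[h(θ_k Y) 1{|Y_k| > 1}] = E[h(Y) 1{|Y_{−k}| > 1}]` for every measurable nonnegative `h`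
and every `k ∈ ℤ^d`. -/
def TailIdentity {Ω : Type*} [MeasurableSpace Ω] (μ : Measure Ω) (Y : Ω → RField d) : Prop :=
  ∀ h : RField d → ℝ≥0∞, Measurable h → ∀ k : Fin d → ℤ,
    ∫⁻ ω, h (shift k (Y ω)) * exIndGT 1 k (Y ω) ∂μ
      = ∫⁻ ω, h (Y ω) * exIndGT 1 (-k) (Y ω) ∂μ

/-- `Y` is exceedance-stationary: for every exceedance-map `τ` which is bijective on a
measurable set `B` (invariant under shifting the origin to exceedance-points, contained in
`ℝ₀^{ℤ^d}`) carrying the law of `Y`, we have `θ_τ Y ≐ Y`. -/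
def ExcStationary {Ω : Type*} [MeasurableSpace Ω] (μ : Measure Ω) (Y : Ω → RField d) : Prop :=
  ∀ (B : Set (RField d)) (τ : RField d → Fin d → ℤ),
    MeasurableSet B → Measurable τ →
    (∀ x ∈ B, 1 < |x 0|) →
    (∀ x ∈ B, ∀ k ∈ excSet x, shift k x ∈ B) →
    (∀ x ∈ B, τ x ∈ excSet x) →
    (∀ x ∈ B, Set.BijOn (fun k => k + τ (shift k x)) (excSet x) (excSet x)) →
    (∀ᵐ ω ∂μ, Y ω ∈ B) →
    Measure.map (fun ω => shift (τ (Y ω)) (Y ω)) μ = Measure.map Y μ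

/-- `E₀`: elements of `ℝ₀^{ℤ^d}` with finitely many exceedance-points. -/
def E0set (d : ℕ) : Set (RField d) := {x | 1 < |x 0| ∧ (excSet x).Finite}

/-- `E`: elements of `ℝ^{ℤ^d}` with at least one but finitely many exceedance-points. -/
def Eset (d : ℕ) : Set (RField d) := {x | (excSet x).Nonempty ∧ (excSet x).Finite}

/-- `l₀`: fields vanishing at infinity. -/
def l0set (d : ℕ) : Set (RField d) := {x | Tendsto (fun i => |x i|) cofinite (nhds 0)}

/-- Uniform norm `‖x‖ = sup_i |x_i|`. -/
def supNorm (x : RField d) : ℝ := ⨆ i, |x i|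

/-- `V` is Pareto(α)-distributed: `P(V > y) = y^{-α}` for `y ≥ 1`. -/
def IsPareto {Ω : Type*} [MeasurableSpace Ω] (μ : Measure Ω) (V : Ω → ℝ) (α : ℝ) : Prop :=
  ∀ y : ℝ, 1 ≤ y → μ {ω | y < V ω} = ENNReal.ofReal (y ^ (-α))

/-- An anchoring function on `S`: a measurable shift-covariant exceedance-map. -/
def IsAnchoringOn (S : Set (RField d)) (A : RField d → Fin d → ℤ) : Prop :=
  Measurable A ∧ ∀ x ∈ S, A x ∈ excSet x ∧ ∀ k ∈ excSet x, A (shift k x) + k = A x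

/-- `h` is shift-invariant on `S`. -/
def ShiftInvariantOn (S : Set (RField d)) (h : RField d → ℝ≥0∞) : Prop :=
  ∀ x ∈ S, ∀ k : Fin d → ℤ, h (shift k x) = h x

open Classical in
/-- The time-change formula with index `α`:
`E[h(|Θ_k|⁻¹ θ_k Θ) 1{Θ_k ≠ 0}] = E[h(Θ) |Θ_{−k}|^α]` for all measurable `h ≥ 0`, `k ∈ ℤ^d`. -/
def TimeChange {d : ℕ} {Ω : Type*} [MeasurableSpace Ω] (μ : Measure Ω)
    (Θ : Ω → RField d) (α : ℝ) : Prop :=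
  ∀ h : RField d → ℝ≥0∞, Measurable h → ∀ k : Fin d → ℤ,
    ∫⁻ ω, (if Θ ω k = 0 then 0 else h (|Θ ω k|⁻¹ • shift k (Θ ω))) ∂μ
      = ∫⁻ ω, h (Θ ω) * ENNReal.ofReal (|Θ ω (-k)| ^ α) ∂μ

lemma shift_apply (k i : Fin d → ℤ) (x : RField d) : shift k x i = x (i + k) := rfl

lemma shift_shift (a b : Fin d → ℤ) (x : RField d) : shift a (shift b x) = shift (a + b) x := by
  funext i
  simp [shift, add_assoc]

@[simp]
lemma shift_zero (x : RField d) : shift 0 x = x := by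
  funext i
  simp [shift]

@[simp]
lemma shift_shift_neg (k : Fin d → ℤ) (x : RField d) : shift k (shift (-k) x) = x := by
  simp [shift_shift]

@[simp]
lemma shift_neg_shift (k : Fin d → ℤ) (x : RField d) : shift (-k) (shift k x) = x := by
  simp [shift_shift]

lemma shift_smul (k : Fin d → ℤ) (c : ℝ) (x : RField d) : shift k (c • x) = c • shift k x := rfl

@[fun_prop]
lemma measurable_shift (k : Fin d → ℤ) : Measurable (shift k : RField d → RField d) := by
  unfold shift
  fun_prop

lemma measurableSet_exceeds (k : Fin d → ℤ) : MeasurableSet {x : RField d | 1 < |x k|} := by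
  measurability

@[fun_prop]
lemma measurable_exIndGT (k : Fin d → ℤ) : Measurable (exIndGT 1 k : RField d → ℝ≥0∞) :=
  Measurable.ite (measurableSet_exceeds k) measurable_const measurable_const

lemma measurable_shift_random {τ : RField d → Fin d → ℤ} (hτ : Measurable τ) :
    Measurable fun x : RField d => shift (τ x) x := by
  have h : Measurable fun p : (Fin d → ℤ) × RField d => shift p.1 p.2 :=
    measurable_from_prod_countable_right fun k => measurable_shift k
  exact h.comp (hτ.prodMk measurable_id)

/-- Swapping the origin with the point at displacement `k`, on a set of fields that is disjoint
from its translate, is a bijective exceedance-shift. -/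
lemma ExcStationary.lintegral_indicator_of_shift_notMem {Ω : Type*} [MeasurableSpace Ω]
    {μ : Measure Ω} {Y : Ω → RField d} (hexc : ExcStationary μ Y) (hY : Measurable Y)
    (h0 : ∀ᵐ ω ∂μ, 1 < |Y ω 0|) {k : Fin d → ℤ} {A : Set (RField d)} (hA : MeasurableSet A)
    (hAk : ∀ x ∈ A, 1 < |x 0| ∧ 1 < |x k|) (hsep : ∀ x ∈ A, shift k x ∉ A)
    {g : RField d → ℝ≥0∞} (hg : Measurable g) :
    ∫⁻ ω, A.indicator (fun x => g (shift k x)) (Y ω) ∂μ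
      = ∫⁻ ω, (shift (-k) ⁻¹' A).indicator g (Y ω) ∂μ := by
  classical
  let τ : RField d → Fin d → ℤ := fun x => if x ∈ A then k else if shift (-k) x ∈ A then -k else 0
  have hsep' : ∀ x, shift (-k) x ∈ A → x ∉ A := fun x hx => by simpa using hsep _ hx
  have hτ : Measurable τ := Measurable.ite hA measurable_const
    (Measurable.ite (measurable_shift (-k) hA) measurable_const measurable_const)
  have hτe : ∀ x : RField d, 1 < |x 0| → 1 < |x (τ x)| := by
    intro x hx
    by_cases h1 : x ∈ A
    · simpa [τ, h1] using (hAk x h1).2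
    by_cases h2 : shift (-k) x ∈ A
    · simpa [τ, h1, h2, shift_apply] using (hAk _ h2).1
    · simpa [τ, h1, h2] using hx
  have hτinv : ∀ x : RField d, τ (shift (τ x) x) = -τ x := by
    intro x
    by_cases h1 : x ∈ A
    · simp [τ, h1, hsep x h1]
    by_cases h2 : shift (-k) x ∈ A
    · simp [τ, h1, h2]
    · simp [τ, h1, h2]
  have key := hexc {x | 1 < |x 0|} τ (measurableSet_exceeds 0) hτ (fun x hx => hx)
    (fun x _ j hj => by simpa [shift_apply, excSet] using hj) hτe
    (fun x _ => by
      have hinv : Set.LeftInvOn (fun j => j + τ (shift j x)) (fun j => j + τ (shift j x))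
          (excSet x) := by
        intro j _
        have h := hτinv (shift j x)
        rw [shift_shift] at h
        simp only
        rw [add_comm j (τ _), h]
        abel
      have hmap : Set.MapsTo (fun j => j + τ (shift j x)) (excSet x) (excSet x) := by
        intro j hj
        have h := hτe (shift j x) (by simpa [shift_apply, excSet] using hj)
        rw [shift_apply, add_comm] at h
        exact h
      exact Set.InvOn.bijOn ⟨hinv, hinv⟩ hmap hmap) h0
  have hf : Measurable ((shift (-k) ⁻¹' A).indicator g) := hg.indicator (measurable_shift (-k) hA)
  have key2 := congrArg (fun P => ∫⁻ x, (shift (-k) ⁻¹' A).indicator g x ∂P) key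
  have hm : Measurable fun ω => shift (τ (Y ω)) (Y ω) := (measurable_shift_random hτ).comp hY
  rw [lintegral_map hf hm, lintegral_map hf hY] at key2
  rw [← key2]
  refine lintegral_congr fun ω => ?_
  generalize Y ω = x
  by_cases h1 : x ∈ A
  · simp [τ, h1]
  by_cases h2 : shift (-k) x ∈ A
  · have h3 : shift (-k) (shift (-k) x) ∉ A := fun h => hsep' _ h h2
    simp [τ, h1, h2, h3]
  · simp [τ, h1, h2]

lemma indicator_shift_eq_of_periodic {k : Fin d → ℤ} {A : Set (RField d)}
    (hper : ∀ x ∈ A, shift k x = x) (g : RField d → ℝ≥0∞) (x : RField d) :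
    A.indicator (fun x => g (shift k x)) x = (shift (-k) ⁻¹' A).indicator g x := by
  by_cases h1 : x ∈ A
  · have h2 : shift (-k) x = x := by
      conv_lhs => rw [← hper x h1]
      simp
    simp [h1, h2, hper x h1]
  · have h2 : shift (-k) x ∉ A := fun h => h1 (by
      have := hper _ h
      rw [shift_shift_neg] at this
      rwa [this])
    simp [h1, h2]

/-- Two measures that agree on all measurable subsets of `C` that are either disjoint from their
translate by `k` or consist of `k`-periodic fields agree on `C`. -/
lemma measure_eq_of_eq_on_separated_of_eq_on_periodic {L₁ L₂ : Measure (RField d)}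
    {k : Fin d → ℤ} {C : Set (RField d)} (hC : MeasurableSet C)
    (hsep : ∀ A ⊆ C, MeasurableSet A → (∀ x ∈ A, shift k x ∉ A) → L₁ A = L₂ A)
    (hper : ∀ A ⊆ C, MeasurableSet A → (∀ x ∈ A, shift k x = x) → L₁ A = L₂ A) :
    L₁ C = L₂ C := by
  let F : Set (RField d) := {x | shift k x = x}
  let D : (Fin d → ℤ) × ℚ × ℚ → Set (RField d) :=
    fun p => {x | p.2.1 * x p.1 < p.2.2 ∧ p.2.2 < p.2.1 * x (p.1 + k)}
  have hF : MeasurableSet F := measurableSet_eq_fun (measurable_shift k) measurable_id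
  have hD : ∀ p, MeasurableSet (D p) := fun p =>
    MeasurableSet.inter
      (measurableSet_lt (f := fun x : RField d => (p.2.1 : ℝ) * x p.1) (by fun_prop)
        measurable_const)
      (measurableSet_lt (g := fun x : RField d => (p.2.1 : ℝ) * x (p.1 + k)) measurable_const
        (by fun_prop))
  have hDsep : ∀ p, ∀ x ∈ D p, shift k x ∉ D p := by
    rintro ⟨i, s, q⟩ x hx hx'
    simp only [D, Set.mem_ofPred_eq, shift_apply] at hx hx'
    linarith [hx.2, hx'.1]
  let U : Option ((Fin d → ℤ) × ℚ × ℚ) → Set (RField d) := fun o => o.elim F D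
  have hcover : ⋃ o, U o = Set.univ := by
    refine Set.eq_univ_of_forall fun x => ?_
    by_cases hx : x ∈ F
    · exact Set.mem_iUnion.2 ⟨none, hx⟩
    · obtain ⟨i, hi⟩ : ∃ i, shift k x i ≠ x i := by
        by_contra! h
        exact hx (funext h)
      rcases lt_or_gt_of_ne hi with h | h
      · obtain ⟨q, hq1, hq2⟩ := exists_rat_btwn h
        refine Set.mem_iUnion.2 ⟨some (i, -1, -q), ?_⟩
        simp only [shift_apply] at hq1
        simp [U, D, hq1, hq2]
      · obtain ⟨q, hq1, hq2⟩ := exists_rat_btwn h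
        refine Set.mem_iUnion.2 ⟨some (i, 1, q), ?_⟩
        simp only [shift_apply] at hq2
        simp [U, D, hq1, hq2]
  have hU : ∀ o, (L₁.restrict C).restrict (U o) = (L₂.restrict C).restrict (U o) := by
    intro o
    have hUo : MeasurableSet (U o) := by
      cases o with
      | none => exact hF
      | some p => exact hD p
    ext S hS
    rw [Measure.restrict_apply hS, Measure.restrict_apply hS, Measure.restrict_apply (hS.inter hUo),
      Measure.restrict_apply (hS.inter hUo)]
    have hm : MeasurableSet (S ∩ U o ∩ C) := (hS.inter hUo).inter hC
    cases o with
    | none => exact hper _ Set.inter_subset_right hm fun x hx => hx.1.2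
    | some p =>
      exact hsep _ Set.inter_subset_right hm fun x hx hx' => hDsep p x hx.1.2 hx'.1.2
  have h := Measure.restrict_iUnion_congr.2 hU
  rw [hcover, Measure.restrict_univ, Measure.restrict_univ] at h
  simpa using congrArg (fun L => L Set.univ) h

lemma ExcStationary.tailIdentity {Ω : Type*} [MeasurableSpace Ω] {μ : Measure Ω}
    {Y : Ω → RField d} (hexc : ExcStationary μ Y) (hY : Measurable Y)
    (h0 : ∀ᵐ ω ∂μ, 1 < |Y ω 0|) : TailIdentity μ Y := by
  intro h hh k
  let C : Set (RField d) := {x | 1 < |x 0| ∧ 1 < |x k|}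
  have hC : MeasurableSet C := (measurableSet_exceeds 0).inter (measurableSet_exceeds k)
  let L₁ : Measure (RField d) := (μ.map Y).withDensity fun x => h (shift k x)
  let L₂ : Measure (RField d) := ((μ.map Y).withDensity h).map (shift (-k))
  have hL₁ : ∀ A, MeasurableSet A →
      L₁ A = ∫⁻ ω, A.indicator (fun x => h (shift k x)) (Y ω) ∂μ := by
    intro A hA
    have hhk : Measurable fun x => h (shift k x) := hh.comp (measurable_shift k)
    rw [withDensity_apply _ hA, ← lintegral_indicator hA, lintegral_map (hhk.indicator hA) hY]
  have hL₂ : ∀ A, MeasurableSet A →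
      L₂ A = ∫⁻ ω, (shift (-k) ⁻¹' A).indicator h (Y ω) ∂μ := by
    intro A hA
    have hA' := measurable_shift (-k) hA
    rw [Measure.map_apply (measurable_shift _) hA, withDensity_apply _ hA',
      ← lintegral_indicator hA', lintegral_map (hh.indicator hA') hY]
  have hLC : L₁ C = L₂ C := by
    refine measure_eq_of_eq_on_separated_of_eq_on_periodic (k := k) hC ?_ ?_
    · intro A hAC hA hsep
      rw [hL₁ A hA, hL₂ A hA]
      exact hexc.lintegral_indicator_of_shift_notMem hY h0 hA (fun x hx => hAC hx) hsep hh
    · intro A _ hA hper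
      rw [hL₁ A hA, hL₂ A hA]
      exact lintegral_congr fun ω => indicator_shift_eq_of_periodic hper h _
  rw [hL₁ C hC, hL₂ C hC] at hLC
  convert hLC using 1
  · refine lintegral_congr_ae ?_
    filter_upwards [h0] with ω hω
    by_cases hk : 1 < |Y ω k| <;> simp [exIndGT, C, hω, hk]
  · refine lintegral_congr_ae ?_
    filter_upwards [h0] with ω hω
    by_cases hk : 1 < |Y ω (-k)| <;> simp [exIndGT, C, hω, hk, shift_apply, Set.indicator]

lemma TailIdentity.excStationary {Ω : Type*} [MeasurableSpace Ω] {μ : Measure Ω}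
    {Y : Ω → RField d} (htail : TailIdentity μ Y) (hY : Measurable Y) : ExcStationary μ Y := by
  classical
  intro B τ _ hτ hB0 hBshift hτe hbij hYB
  ext S hS
  have hm : Measurable fun ω => shift (τ (Y ω)) (Y ω) := (measurable_shift_random hτ).comp hY
  rw [← lintegral_indicator_one hS, ← lintegral_indicator_one hS,
    lintegral_map (measurable_one.indicator hS) hm, lintegral_map (measurable_one.indicator hS) hY]
  let h : (Fin d → ℤ) → RField d → ℝ≥0∞ := fun k x =>
    S.indicator 1 x * if τ (shift (-k) x) = k then 1 else 0
  have hh : ∀ k, Measurable (h k) := fun k =>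
    (measurable_one.indicator hS).mul (Measurable.ite
      ((hτ.comp (measurable_shift (-k))) (measurableSet_singleton k)) measurable_const
      measurable_const)
  have hsum := congrArg (fun f : (Fin d → ℤ) → ℝ≥0∞ => ∑' k, f k)
    (funext fun k => htail (h k) (hh k) k)
  rw [← lintegral_tsum fun k => by
      have := hh k
      exact Measurable.aemeasurable (by fun_prop),
    ← lintegral_tsum fun k => by
      have := hh k
      exact Measurable.aemeasurable (by fun_prop)] at hsum
  convert hsum using 1
  · refine lintegral_congr_ae ?_
    filter_upwards [hYB] with ω hω
    generalize Y ω = x at hω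
    rw [tsum_eq_single (τ x)]
    · have := hτe x hω
      simp only [excSet, Set.mem_ofPred_eq] at this
      simp [h, exIndGT, this]
    · intro k hk
      simp [h, hk.symm]
  · refine lintegral_congr_ae ?_
    filter_upwards [hYB] with ω hω
    generalize Y ω = x at hω
    have h0 : (0 : Fin d → ℤ) ∈ excSet x := hB0 x hω
    obtain ⟨j, hj, hj0⟩ := (hbij x hω).surjOn h0
    simp only at hj0
    rw [tsum_eq_single (-j)]
    · have hj' : τ (shift j x) = -j := (neg_eq_of_add_eq_zero_right hj0).symm
      simp only [excSet, Set.mem_ofPred_eq] at hj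
      simp [h, exIndGT, hj, hj']
    · intro k hk
      by_cases h1 : τ (shift (-k) x) = k
      · have h2 : ¬ 1 < |x (-k)| := by
          intro h2
          apply hk
          have := (hbij x hω).injOn (x₁ := -k) (x₂ := j) h2 hj (by simp [h1, hj0])
          rw [← this, neg_neg]
        simp [exIndGT, h2]
      · simp [h, h1]

lemma IsPareto.map_Ioi {Ω : Type*} [MeasurableSpace Ω] {μ : Measure Ω} [IsProbabilityMeasure μ]
    {V : Ω → ℝ} (hV : Measurable V) {α : ℝ} (hVp : IsPareto μ V α) (y : ℝ) :
    μ.map V (Set.Ioi y) = ENNReal.ofReal (max y 1 ^ (-α)) := by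
  have hP : IsProbabilityMeasure (μ.map V) := Measure.isProbabilityMeasure_map hV.aemeasurable
  have key : ∀ z, 1 ≤ z → μ.map V (Set.Ioi z) = ENNReal.ofReal (z ^ (-α)) := fun z hz => by
    rw [Measure.map_apply hV measurableSet_Ioi]
    exact hVp z hz
  rcases le_total 1 y with h | h
  · rw [max_eq_left h, key y h]
  · rw [max_eq_right h]
    have h1 := key 1 le_rfl
    simp only [Real.one_rpow, ENNReal.ofReal_one] at h1 ⊢
    exact le_antisymm prob_le_one (h1 ▸ measure_mono (Set.Ioi_subset_Ioi h))

lemma IsPareto.ae_one_lt {Ω : Type*} [MeasurableSpace Ω] {μ : Measure Ω} [IsProbabilityMeasure μ]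
    {V : Ω → ℝ} (hV : Measurable V) {α : ℝ} (hVp : IsPareto μ V α) :
    ∀ᵐ v ∂μ.map V, 1 < v := by
  have hP : IsProbabilityMeasure (μ.map V) := Measure.isProbabilityMeasure_map hV.aemeasurable
  have h := hVp.map_Ioi hV 1
  simp only [max_self, Real.one_rpow, ENNReal.ofReal_one] at h
  exact (prob_compl_eq_zero_iff measurableSet_Ioi).2 h

/-- Scaling property of the Pareto law. -/
lemma IsPareto.lintegral_indicator_mul {Ω : Type*} [MeasurableSpace Ω] {μ : Measure Ω}
    [IsProbabilityMeasure μ] {V : Ω → ℝ} (hV : Measurable V) {α : ℝ}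
    (hVp : IsPareto μ V α) {t : ℝ} (ht : 0 < t) {G : ℝ → ℝ≥0∞} (hG : Measurable G) :
    ∫⁻ v, (Set.Ioi 1).indicator G (v * t) ∂μ.map V
      = ENNReal.ofReal (t ^ α) * ∫⁻ v, (Set.Ioi t).indicator G v ∂μ.map V := by
  have hP : IsProbabilityMeasure (μ.map V) := Measure.isProbabilityMeasure_map hV.aemeasurable
  have hmt : Measurable fun v : ℝ => v * t := measurable_id.mul_const t
  have hmax : ∀ y, ((μ.map V).map (· * t)).restrict (Set.Ioi 1) (Set.Ioi y)
      = (ENNReal.ofReal (t ^ α) • (μ.map V).restrict (Set.Ioi t)) (Set.Ioi y) := by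
    intro y
    have hpre : (fun v : ℝ => v * t) ⁻¹' (Set.Ioi (max y 1)) = Set.Ioi (max y 1 / t) := by
      ext v
      simp only [Set.mem_preimage, Set.mem_Ioi]
      exact (div_lt_iff₀ ht).symm
    rw [Measure.restrict_apply measurableSet_Ioi, Measure.smul_apply,
      Measure.restrict_apply measurableSet_Ioi, Set.Ioi_inter_Ioi, Set.Ioi_inter_Ioi,
      Measure.map_apply hmt measurableSet_Ioi, hpre, hVp.map_Ioi hV, hVp.map_Ioi hV, smul_eq_mul,
      ← ENNReal.ofReal_mul (by positivity)]
    congr 1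
    have h1 : max (max y 1 / t) 1 = max (max y t) 1 / t := by
      rw [max_right_comm, ← max_div_div_right ht.le _ t, div_self ht.ne']
    have h2 : (0 : ℝ) ≤ max (max y t) 1 := le_max_of_le_right zero_le_one
    rw [h1, Real.div_rpow h2 ht.le, Real.rpow_neg ht.le, div_inv_eq_mul, mul_comm]
  have hmeas : ((μ.map V).map (· * t)).restrict (Set.Ioi 1)
      = ENNReal.ofReal (t ^ α) • (μ.map V).restrict (Set.Ioi t) := by
    have hfin : IsFiniteMeasure ((μ.map V).map (· * t)) := inferInstance
    refine ext_of_generate_finite (Set.range Set.Ioi)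
      ((borel_eq_generateFrom_Ioi ℝ) ▸ BorelSpace.measurable_eq) isPiSystem_Ioi ?_ ?_
    · rintro _ ⟨y, rfl⟩
      exact hmax y
    · have h := hmax (min 1 t)
      rw [Measure.restrict_apply measurableSet_Ioi, Measure.smul_apply,
        Measure.restrict_apply measurableSet_Ioi,
        Set.inter_eq_right.2 (Set.Ioi_subset_Ioi (min_le_left 1 t)),
        Set.inter_eq_right.2 (Set.Ioi_subset_Ioi (min_le_right 1 t))] at h
      rw [Measure.smul_apply, Measure.restrict_apply_univ, Measure.restrict_apply_univ, h]
  rw [← lintegral_map (f := (Set.Ioi 1).indicator G) (hG.indicator measurableSet_Ioi) hmt,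
    lintegral_indicator measurableSet_Ioi, lintegral_indicator measurableSet_Ioi, hmeas,
    lintegral_smul_measure, smul_eq_mul]

lemma IsPareto.map_one_lt_mul {Ω : Type*} [MeasurableSpace Ω] {μ : Measure Ω}
    [IsProbabilityMeasure μ] {V : Ω → ℝ} (hV : Measurable V) {α : ℝ}
    (hVp : IsPareto μ V α) {s : ℝ} (hs : 0 < s) :
    μ.map V {v | 1 < v * s} = ENNReal.ofReal (max 1 s⁻¹ ^ (-α)) := by
  have hset : {v : ℝ | 1 < v * s} = Set.Ioi s⁻¹ := by
    ext v
    simp only [Set.mem_ofPred_eq, Set.mem_Ioi]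
    exact (inv_lt_iff_one_lt_mul₀ hs).symm
  rw [hset, hVp.map_Ioi hV, max_comm]

lemma IsPareto.max_inv_rpow_mul_map {Ω : Type*} [MeasurableSpace Ω] {μ : Measure Ω}
    [IsProbabilityMeasure μ] {V : Ω → ℝ} (hV : Measurable V) {α : ℝ}
    (hVp : IsPareto μ V α) {s : ℝ} (hs : 0 < s) :
    ENNReal.ofReal (max 1 s⁻¹ ^ α) * μ.map V {v | 1 < v * s} = 1 := by
  have hm : (0 : ℝ) < max 1 s⁻¹ := lt_max_of_lt_left one_pos
  rw [hVp.map_one_lt_mul hV hs, ← ENNReal.ofReal_mul (by positivity), ← Real.rpow_add hm]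
  simp

lemma IsPareto.max_rpow_mul_map {Ω : Type*} [MeasurableSpace Ω] {μ : Measure Ω}
    [IsProbabilityMeasure μ] {V : Ω → ℝ} (hV : Measurable V) {α : ℝ} (hα : 0 < α)
    (hVp : IsPareto μ V α) {s : ℝ} (hs : 0 ≤ s) :
    ENNReal.ofReal (max 1 s ^ α) * μ.map V {v | 1 < v * s} = ENNReal.ofReal (s ^ α) := by
  rcases hs.eq_or_lt with rfl | hs
  · simp [Real.zero_rpow hα.ne', not_lt.2 zero_le_one]
  have hm : (0 : ℝ) < max 1 s⁻¹ := lt_max_of_lt_left one_pos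
  have h : max 1 s = s * max 1 s⁻¹ := by
    rw [mul_max_of_nonneg _ _ hs.le, mul_one, mul_inv_cancel₀ hs.ne', max_comm]
  rw [h, Real.mul_rpow hs.le hm.le, ENNReal.ofReal_mul (by positivity), mul_assoc,
    hVp.map_one_lt_mul hV hs, ← ENNReal.ofReal_mul (by positivity), ← Real.rpow_add hm]
  simp

lemma lintegral_indepFun {Ω E : Type*} [MeasurableSpace Ω] [MeasurableSpace E] {μ : Measure Ω}
    [IsProbabilityMeasure μ] {V : Ω → ℝ} (hV : Measurable V) {Θ : Ω → E}
    (hΘ : Measurable Θ) (hind : IndepFun V Θ μ) {F : E × ℝ → ℝ≥0∞} (hF : Measurable F) :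
    ∫⁻ ω, F (Θ ω, V ω) ∂μ = ∫⁻ ω, ∫⁻ v, F (Θ ω, v) ∂μ.map V ∂μ := by
  have hP : IsProbabilityMeasure (μ.map V) := Measure.isProbabilityMeasure_map hV.aemeasurable
  have h := (indepFun_iff_map_prod_eq_prod_map_map hΘ.aemeasurable hV.aemeasurable).1 hind.symm
  rw [← lintegral_map hF (hΘ.prodMk hV), h, lintegral_prod _ hF.aemeasurable,
    lintegral_map hF.lintegral_prod_right' hΘ]

@[fun_prop]
lemma measurable_snd_smul_fst : Measurable fun p : RField d × ℝ => p.2 • p.1 :=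
  measurable_pi_lambda _ fun i => measurable_snd.mul ((measurable_pi_apply i).comp measurable_fst)

lemma TimeChange.tailIdentity
    {Ω : Type*} [MeasurableSpace Ω] {μ : Measure Ω} [IsProbabilityMeasure μ]
    {Θ : Ω → RField d} (hΘ : Measurable Θ) (hΘ0 : ∀ᵐ ω ∂μ, |Θ ω 0| = 1)
    {α : ℝ} (hα : 0 < α) {V : Ω → ℝ} (hV : Measurable V) (hVp : IsPareto μ V α)
    (hind : IndepFun V Θ μ) (htc : TimeChange μ Θ α) :
    TailIdentity μ (fun ω => V ω • Θ ω) := by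
  intro g hg k
  have hP : IsProbabilityMeasure (μ.map V) := Measure.isProbabilityMeasure_map hV.aemeasurable
  let F : RField d × ℝ → ℝ≥0∞ := fun p => g (p.2 • p.1) * exIndGT 1 (-k) (p.2 • p.1)
  have hF : Measurable F := by fun_prop
  let H : RField d → ℝ≥0∞ := fun x =>
    ENNReal.ofReal (|x (-k)| ^ (-α)) * ∫⁻ v, F (x, v) ∂μ.map V
  have hH : Measurable H := by
    refine Measurable.mul ?_ hF.lintegral_prod_right'
    have : Measurable fun x : RField d => |x (-k)| :=
      continuous_abs.measurable.comp (measurable_pi_apply (-k))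
    exact (this.pow_const (-α)).ennreal_ofReal
  have hl := lintegral_indepFun hV hΘ hind
    (F := fun p => g (shift k (p.2 • p.1)) * exIndGT 1 k (p.2 • p.1)) (by fun_prop)
  have hr := lintegral_indepFun hV hΘ hind hF
  simp only [F] at hl hr
  rw [hl, hr]
  convert htc H hH k using 1
  · refine lintegral_congr_ae ?_
    filter_upwards [hΘ0] with ω hω
    generalize Θ ω = x at hω
    by_cases hk : x k = 0
    · simp [hk, exIndGT, not_lt.2 zero_le_one]
    have ht : 0 < |x k| := abs_pos.2 hk
    have hG : Measurable fun u : ℝ => g (u • (|x k|⁻¹ • shift k x)) := by fun_prop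
    have hx : |(|x k|⁻¹ • shift k x) (-k)| = |x k|⁻¹ := by
      simp [shift_apply, hω, abs_mul]
    simp only [hk, if_false, H, hx, F]
    rw [Real.inv_rpow ht.le, Real.rpow_neg ht.le, inv_inv]
    convert hVp.lintegral_indicator_mul hV ht hG using 1
    · refine lintegral_congr_ae ?_
      filter_upwards [hVp.ae_one_lt hV] with v hv
      have hv0 : |v| = v := abs_of_pos (by linarith)
      have e : (v * |x k|) • (|x k|⁻¹ • shift k x) = shift k (v • x) := by
        rw [smul_smul, mul_assoc, mul_inv_cancel₀ ht.ne', mul_one, shift_smul]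
      simp [exIndGT, Set.indicator, abs_mul, hv0, e]
    · congr 1
      refine lintegral_congr_ae ?_
      filter_upwards [hVp.ae_one_lt hV] with v hv
      have hv0 : |v| = v := abs_of_pos (by linarith)
      have e : (1 < v * |x k|⁻¹) ↔ |x k| < v := by
        rw [← div_eq_mul_inv, one_lt_div ht]
      have e2 : |(v • |x k|⁻¹ • shift k x) (-k)| = v * |x k|⁻¹ := by
        rw [Pi.smul_apply, smul_eq_mul, abs_mul, hx, hv0]
      simp only [exIndGT, e2, e, Set.indicator, Set.mem_Ioi]
      split_ifs <;> simp
  · refine lintegral_congr fun ω => ?_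
    generalize Θ ω = x
    by_cases hk : x (-k) = 0
    · simp [hk, exIndGT, not_lt.2 zero_le_one, Real.zero_rpow hα.ne']
    have ht : 0 < |x (-k)| := abs_pos.2 hk
    simp only [H, F]
    rw [mul_right_comm, ← ENNReal.ofReal_mul (by positivity), ← Real.rpow_add ht]
    simp

lemma TailIdentity.timeChange
    {Ω : Type*} [MeasurableSpace Ω] {μ : Measure Ω} [IsProbabilityMeasure μ]
    {Θ : Ω → RField d} (hΘ : Measurable Θ) (hΘ0 : ∀ᵐ ω ∂μ, |Θ ω 0| = 1)
    {α : ℝ} (hα : 0 < α) {V : Ω → ℝ} (hV : Measurable V) (hVp : IsPareto μ V α)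
    (hind : IndepFun V Θ μ) (htail : TailIdentity μ (fun ω => V ω • Θ ω)) :
    TimeChange μ Θ α := by
  intro h hh k
  let g : RField d → ℝ≥0∞ := fun x =>
    h (|x 0|⁻¹ • x) * ENNReal.ofReal (max 1 (|x (-k)| / |x 0|) ^ α)
  have habs : ∀ j, Measurable fun x : RField d => |x j| := fun j =>
    continuous_abs.measurable.comp (measurable_pi_apply j)
  have hg : Measurable g := by
    refine (hh.comp ?_).mul ?_
    · exact measurable_pi_lambda _ fun i => (habs 0).inv.mul (measurable_pi_apply i)
    · exact ((measurable_const.max ((habs (-k)).div (habs 0))).pow_const α).ennreal_ofReal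
  have ht := htail g hg k
  have hl := lintegral_indepFun hV hΘ hind
    (F := fun p => g (shift k (p.2 • p.1)) * exIndGT 1 k (p.2 • p.1)) (by fun_prop)
  have hr := lintegral_indepFun hV hΘ hind
    (F := fun p => g (p.2 • p.1) * exIndGT 1 (-k) (p.2 • p.1)) (by fun_prop)
  simp only at hl hr
  rw [hl, hr] at ht
  have hset : ∀ s : ℝ, MeasurableSet {v : ℝ | 1 < v * s} := fun s =>
    measurableSet_lt measurable_const (measurable_id.mul_const s)
  have hconst : ∀ (x : RField d) (j : Fin d → ℤ) (c : ℝ≥0∞) (f : RField d → ℝ≥0∞),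
      (∀ v : ℝ, 1 < v → f (v • x) = c) →
      ∫⁻ v, f (v • x) * exIndGT 1 j (v • x) ∂μ.map V = c * μ.map V {v | 1 < v * |x j|} := by
    intro x j c f hf
    rw [← lintegral_indicator_const (hset _)]
    refine lintegral_congr_ae ?_
    filter_upwards [hVp.ae_one_lt hV] with v hv
    have hv0 : |v| = v := abs_of_pos (by linarith)
    simp [hf v hv, exIndGT, abs_mul, hv0, Set.indicator]
  have hgv : ∀ (x : RField d) (v : ℝ), 1 < v → g (v • x) = g x := by
    intro x v hv
    have hv0 : 0 < v := by linarith
    have e1 : |(v • x) 0|⁻¹ • (v • x) = |x 0|⁻¹ • x := by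
      rw [smul_smul, Pi.smul_apply, smul_eq_mul, abs_mul, abs_of_pos hv0, mul_inv_rev, mul_assoc,
        inv_mul_cancel₀ hv0.ne', mul_one]
    have e2 : |(v • x) (-k)| / |(v • x) 0| = |x (-k)| / |x 0| := by
      simp only [Pi.smul_apply, smul_eq_mul, abs_mul]
      exact mul_div_mul_left _ _ (abs_pos.2 hv0.ne').ne'
    simp only [g, e1, e2]
  convert ht using 1
  · refine lintegral_congr_ae ?_
    filter_upwards [hΘ0] with ω hω
    generalize Θ ω = x at hω
    rw [hconst x k (g (shift k x)) (fun y => g (shift k y)) fun v hv => hgv (shift k x) v hv]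
    by_cases hk : x k = 0
    · simp [hk, not_lt.2 zero_le_one]
    have e : g (shift k x) = h (|x k|⁻¹ • shift k x) * ENNReal.ofReal (max 1 |x k|⁻¹ ^ α) := by
      simp [g, shift_apply, hω]
    rw [e, mul_assoc, hVp.max_inv_rpow_mul_map hV (abs_pos.2 hk), mul_one, if_neg hk]
  · refine lintegral_congr_ae ?_
    filter_upwards [hΘ0] with ω hω
    generalize Θ ω = x at hω
    rw [hconst x (-k) (g x) g fun v hv => hgv _ v hv]
    have e : g x = h x * ENNReal.ofReal (max 1 |x (-k)| ^ α) := by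
      simp [g, hω]
    rw [e, mul_assoc, hVp.max_rpow_mul_map hV hα (abs_nonneg _)]

/-- For `Θ` with `|Θ_0| = 1` a.s. and `V` Pareto(α)-distributed and
independent of `Θ`, the time-change formula of index `α` holds for `Θ` if and only if
`Y := V·Θ` is exceedance-stationary. -/
theorem timeChange_iff_exceedanceStationary
    {Ω : Type*} [MeasurableSpace Ω] (μ : Measure Ω) [IsProbabilityMeasure μ]
    (Θ : Ω → RField d) (hΘ : Measurable Θ) (hΘ0 : ∀ᵐ ω ∂μ, |Θ ω 0| = 1)
    (α : ℝ) (hα : 0 < α)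
    (V : Ω → ℝ) (hV : Measurable V) (hVp : IsPareto μ V α)
    (hind : IndepFun V Θ μ) :
    TimeChange μ Θ α ↔ ExcStationary μ (fun ω => V ω • Θ ω) := by
  have hY : Measurable fun ω => V ω • Θ ω := measurable_snd_smul_fst.comp (hΘ.prodMk hV)
  have h0 : ∀ᵐ ω ∂μ, 1 < |(V ω • Θ ω) 0| := by
    filter_upwards [hΘ0, ae_of_ae_map hV.aemeasurable (hVp.ae_one_lt hV)] with ω h1 h2
    rw [Pi.smul_apply, smul_eq_mul, abs_mul, h1, mul_one]
    exact lt_of_lt_of_le h2 (le_abs_self _)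
  exact ⟨fun htc => (htc.tailIdentity hΘ hΘ0 hα hV hVp hind).excStationary hY,
    fun hexc => (hexc.tailIdentity hY h0).timeChange hΘ hΘ0 hα hV hVp hind⟩
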